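/- (Coercivity identity underlying Theorem 3.1.) Let v ∈ C_c^∞(Λ) and let v_e : ℝ → ℝ be the extension of v by zero outside Λ. Then (D^{δ,ψ}_t v, v)_{L²_ψ(Λ)} = cos(πδ/2) · ∫_ℝ |(_{-∞}D^{δ/2,ψ}_t v_e)(t)|² ψ'(t) dt; in particular (D^{δ,ψ}_t v, v)_{L²_ψ(Λ)} ≥ 0. -/

import Mathlib

open MeasureTheory Real

/-- Left ψ-fractional integral on `Λ = (a,b)`. -/
noncomputable def leftPsiI (ψ : ℝ → ℝ) (a μ : ℝ) (v : ℝ → ℝ) (t : ℝ) : ℝ :=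
  (1 / Real.Gamma μ) * ∫ z in a..t, deriv ψ z * (ψ t - ψ z) ^ (μ - 1) * v z

/-- Left ψ-Riemann–Liouville derivative on `Λ = (a,b)`. -/
noncomputable def leftPsiD (ψ : ℝ → ℝ) (a μ : ℝ) (v : ℝ → ℝ) (t : ℝ) : ℝ :=
  (1 / deriv ψ t) * deriv (fun τ => leftPsiI ψ a (1 - μ) v τ) t

/-- Left ψ-Riemann–Liouville derivative on the whole line. -/
noncomputable def leftRLDLine (ψ : ℝ → ℝ) (μ : ℝ) (v : ℝ → ℝ) (t : ℝ) : ℝ :=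
  (1 / deriv ψ t) *
    deriv (fun τ => (1 / Real.Gamma (1 - μ)) *
      ∫ z in Set.Iio τ, deriv ψ z * (ψ τ - ψ z) ^ (-μ) * v z) t

/-- Laplace-type parametrisation of the Beta integral on the half-line. -/
theorem integrable_prod_rpow_mul_rpow_mul_exp {α h : ℝ} (hα0 : 0 < α) (hα1 : α < 1) (hh : 0 < h) :
    Integrable (fun p : ℝ × ℝ => p.1 ^ (-α) * (p.2 ^ α * exp (-((p.1 + h) * p.2))))
      ((volume.restrict (Set.Ioi 0)).prod (volume.restrict (Set.Ioi 0))) := by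
  have hmeas : Measurable
      (fun p : ℝ × ℝ => p.1 ^ (-α) * (p.2 ^ α * exp (-((p.1 + h) * p.2)))) := by
    fun_prop
  have hslice : ∀ t : ℝ, 0 < t →
      IntegrableOn (fun u => u ^ (-α) * (t ^ α * exp (-((u + h) * t)))) (Set.Ioi 0) := by
    intro t ht
    have := (integrableOn_rpow_mul_exp_neg_mul_rpow (p := 1) (s := -α) (b := t)
      (by linarith) one_pos ht).mul_const (t ^ α * exp (-(h * t)))
    refine IntegrableOn.congr_fun this (fun u _ => ?_) measurableSet_Ioi
    simp only [rpow_one]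
    rw [show -((u + h) * t) = -t * u + -(h * t) by ring, exp_add]
    ring
  rw [integrable_prod_iff' hmeas.aestronglyMeasurable]
  refine ⟨(ae_restrict_iff' measurableSet_Ioi).2 (.of_forall fun t ht => hslice t ht), ?_⟩
  have hint : IntegrableOn (fun t : ℝ => Gamma (1 - α) * (t ^ (2 * α - 1) * exp (-h * t ^ (1 : ℝ))))
      (Set.Ioi 0) :=
    (integrableOn_rpow_mul_exp_neg_mul_rpow (by linarith) one_pos hh).const_mul _
  refine IntegrableOn.congr_fun hint (fun t ht => ?_) measurableSet_Ioi
  have ht : 0 < t := ht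
  have : ∫ u in Set.Ioi (0 : ℝ), ‖u ^ (-α) * (t ^ α * exp (-((u + h) * t)))‖
      = ∫ u in Set.Ioi (0 : ℝ), (u ^ ((1 - α) - 1) * exp (-(t * u))) * (t ^ α * exp (-(h * t))) := by
    refine setIntegral_congr_fun measurableSet_Ioi (fun u hu => ?_)
    have hu : 0 < u := hu
    rw [norm_of_nonneg (by positivity), show -((u + h) * t) = -(t * u) + -(h * t) by ring, exp_add,
      show 1 - α - 1 = -α by ring]
    ring
  simp only
  rw [this, integral_mul_const, integral_rpow_mul_exp_neg_mul_Ioi (by linarith) ht, rpow_one,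
    one_div, inv_rpow ht.le, ← rpow_neg ht.le, show 2 * α - 1 = -(1 - α) + α by ring, rpow_add ht]
  ring_nf

theorem integral_rpow_mul_rpow_mul_exp {α h u : ℝ} (hα0 : 0 < α) (hh : 0 < h) (hu : 0 < u) :
    ∫ t in Set.Ioi (0 : ℝ), u ^ (-α) * (t ^ α * exp (-((u + h) * t)))
      = Gamma (1 + α) * (u ^ (-α) * (u + h) ^ (-1 - α)) := by
  have := integral_rpow_mul_exp_neg_mul_Ioi (a := 1 + α) (r := u + h) (by linarith) (by linarith)
  rw [show 1 + α - 1 = α by ring] at this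
  rw [integral_const_mul, this, one_div, inv_rpow (by positivity), ← rpow_neg (by positivity),
    show -(1 + α) = -1 - α by ring]
  ring

theorem integrableOn_rpow_mul_add_rpow {α h : ℝ} (hα0 : 0 < α) (hα1 : α < 1) (hh : 0 < h) :
    IntegrableOn (fun u : ℝ => u ^ (-α) * (u + h) ^ (-1 - α)) (Set.Ioi 0) := by
  have := (integrable_prod_rpow_mul_rpow_mul_exp hα0 hα1 hh).integral_prod_left
  have hG : Gamma (1 + α) ≠ 0 := (Gamma_pos_of_pos (by linarith)).ne'
  refine IntegrableOn.congr_fun (Integrable.const_mul this (Gamma (1 + α))⁻¹)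
    (fun u hu => ?_) measurableSet_Ioi
  simp only
  rw [integral_rpow_mul_rpow_mul_exp hα0 hh hu]
  field_simp

theorem integral_rpow_mul_add_rpow {α h : ℝ} (hα0 : 0 < α) (hα1 : α < 1) (hh : 0 < h) :
    ∫ u in Set.Ioi (0 : ℝ), u ^ (-α) * (u + h) ^ (-1 - α)
      = Gamma (1 - α) * Gamma (2 * α) / Gamma (1 + α) * h ^ (-(2 * α)) := by
  have hG : Gamma (1 + α) ≠ 0 := (Gamma_pos_of_pos (by linarith)).ne'
  have hswap := integral_integral_swap (f := fun u t : ℝ => u ^ (-α) * (t ^ α * exp (-((u + h) * t))))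
    (integrable_prod_rpow_mul_rpow_mul_exp hα0 hα1 hh)
  rw [setIntegral_congr_fun measurableSet_Ioi
    (fun u hu => integral_rpow_mul_rpow_mul_exp hα0 hh hu), integral_const_mul] at hswap
  have hR : ∫ t in Set.Ioi (0 : ℝ), ∫ u in Set.Ioi (0 : ℝ), u ^ (-α) * (t ^ α * exp (-((u + h) * t)))
      = ∫ t in Set.Ioi (0 : ℝ), Gamma (1 - α) * (t ^ (2 * α - 1) * exp (-(h * t))) := by
    refine setIntegral_congr_fun measurableSet_Ioi (fun t ht => ?_)
    have ht : 0 < t := ht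
    have : ∫ u in Set.Ioi (0 : ℝ), u ^ (-α) * (t ^ α * exp (-((u + h) * t)))
        = ∫ u in Set.Ioi (0 : ℝ),
          (u ^ ((1 - α) - 1) * exp (-(t * u))) * (t ^ α * exp (-(h * t))) := by
      refine setIntegral_congr_fun measurableSet_Ioi (fun u hu => ?_)
      rw [show -((u + h) * t) = -(t * u) + -(h * t) by ring, exp_add,
        show 1 - α - 1 = -α by ring]
      ring
    rw [this, integral_mul_const, integral_rpow_mul_exp_neg_mul_Ioi (by linarith) ht,
      one_div, inv_rpow ht.le, ← rpow_neg ht.le, show 2 * α - 1 = -(1 - α) + α by ring, rpow_add ht]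
    ring
  rw [hR, integral_const_mul, integral_rpow_mul_exp_neg_mul_Ioi (by linarith) hh, one_div,
    inv_rpow hh.le, ← rpow_neg hh.le] at hswap
  rw [eq_comm, div_mul_eq_mul_div, div_eq_iff hG, mul_comm _ (Gamma (1 + α)), hswap]
  ring

theorem gamma_constant {α : ℝ} (hα0 : 0 < α) (hα1 : α < 1 / 2) :
    (Gamma (1 - 2 * α))⁻¹ = cos (π * α) * ((Gamma (1 - α))⁻¹ ^ 2 *
      (2 * α * (Gamma (1 - α) * Gamma (2 * α) / Gamma (1 + α)))) := by
  have h1 := Gamma_mul_Gamma_one_sub (2 * α)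
  have h2 := Gamma_mul_Gamma_one_sub α
  have h3 := Gamma_add_one hα0.ne'
  have g1 := Gamma_pos_of_pos (show 0 < 1 - 2 * α by linarith)
  have g2 := Gamma_pos_of_pos (show 0 < 1 - α by linarith)
  have g3 := Gamma_pos_of_pos (show 0 < 2 * α by linarith)
  have g4 := Gamma_pos_of_pos hα0
  have s1 : 0 < sin (π * α) := sin_pos_of_pos_of_lt_pi (by positivity) (by nlinarith [pi_pos])
  have s2 : 0 < cos (π * α) := cos_pos_of_mem_Ioo ⟨by nlinarith [pi_pos], by nlinarith [pi_pos]⟩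
  rw [show π * (2 * α) = 2 * (π * α) by ring, sin_two_mul,
    eq_div_iff (by positivity)] at h1
  rw [eq_div_iff s1.ne'] at h2
  rw [add_comm 1 α, h3]
  field_simp
  have hp := pi_pos
  have : Gamma α * Gamma (1 - α) * sin (π * α)
      = Gamma (2 * α) * Gamma (1 - 2 * α) * (2 * sin (π * α) * cos (π * α)) := by
    rw [h1, h2]
  have := mul_right_cancel₀ s1.ne' (this.trans (by ring : _ = Gamma (2 * α) * Gamma (1 - 2 * α) * (2 * cos (π * α)) * sin (π * α)))
  rw [mul_comm π α] at this
  linarith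

/-- The tempered power kernel `x₊^{-α} e^{-εx}`. -/
noncomputable def temperedKernel (α ε x : ℝ) : ℝ :=
  (Set.Ioi (0 : ℝ)).indicator (fun x => x ^ (-α) * exp (-(ε * x))) x

theorem temperedKernel_of_pos {α ε x : ℝ} (hx : 0 < x) :
    temperedKernel α ε x = x ^ (-α) * exp (-(ε * x)) :=
  Set.indicator_of_mem (Set.mem_Ioi.2 hx) _

theorem temperedKernel_of_nonpos {α ε x : ℝ} (hx : x ≤ 0) : temperedKernel α ε x = 0 :=
  Set.indicator_of_notMem (by simpa using hx) _

theorem temperedKernel_nonneg (α ε x : ℝ) : 0 ≤ temperedKernel α ε x :=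
  Set.indicator_nonneg (fun x hx => by have : 0 < x := hx; positivity) x

theorem temperedKernel_le {α ε : ℝ} (hε : 0 ≤ ε) (x : ℝ) :
    temperedKernel α ε x ≤ temperedKernel α 0 x := by
  rcases le_or_gt x 0 with hx | hx
  · simp [temperedKernel_of_nonpos hx]
  · rw [temperedKernel_of_pos hx, temperedKernel_of_pos hx]
    gcongr

theorem measurable_temperedKernel (α ε : ℝ) : Measurable (temperedKernel α ε) := by
  unfold temperedKernel
  exact Measurable.indicator (by fun_prop) measurableSet_Ioi

theorem integrable_temperedKernel {α ε : ℝ} (hα1 : α < 1) (hε : 0 < ε) :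
    Integrable (temperedKernel α ε) := by
  unfold temperedKernel
  rw [integrable_indicator_iff measurableSet_Ioi]
  simpa using integrableOn_rpow_mul_exp_neg_mul_rpow (p := 1) (s := -α) (by linarith) one_pos hε

theorem integrableOn_temperedKernel_zero {α : ℝ} (hα1 : α < 1) (A B : ℝ) :
    IntegrableOn (temperedKernel α 0) (Set.Icc A B) := by
  have h := (intervalIntegral.intervalIntegrable_rpow' (a := 0) (b := max B 0)
    (show -1 < -α by linarith)).1
  have : IntegrableOn (temperedKernel α 0) (Set.Ioc 0 (max B 0)) :=
    h.congr_fun (fun x hx => by simp [temperedKernel_of_pos hx.1]) measurableSet_Ioc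
  have h0 : IntegrableOn (temperedKernel α 0) (Set.Iic 0) :=
    integrableOn_zero.congr_fun (fun x hx => (temperedKernel_of_nonpos hx).symm) measurableSet_Iic
  refine (h0.union this).mono_set fun x hx => ?_
  rcases le_or_gt x 0 with h | h
  · exact Or.inl h
  · exact Or.inr ⟨h, hx.2.trans (le_max_left _ _)⟩

theorem locallyIntegrable_temperedKernel {α ε : ℝ} (hα1 : α < 1) (hε : 0 ≤ ε) :
    LocallyIntegrable (temperedKernel α ε) := by
  have h0 : LocallyIntegrable (temperedKernel α 0) := by
    refine locallyIntegrable_iff.2 fun K hK => ?_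
    obtain ⟨A, hA⟩ := hK.bddBelow
    obtain ⟨B, hB⟩ := hK.bddAbove
    exact (integrableOn_temperedKernel_zero hα1 A B).mono_set fun x hx => ⟨hA hx, hB hx⟩
  refine h0.mono (measurable_temperedKernel α ε).aestronglyMeasurable (.of_forall fun x => ?_)
  rw [norm_of_nonneg (temperedKernel_nonneg _ _ _), norm_of_nonneg (temperedKernel_nonneg _ _ _)]
  exact temperedKernel_le hε x

theorem hasDerivAt_rpow_mul_exp (α ε : ℝ) {x : ℝ} (hx : 0 < x) :
    HasDerivAt (fun x : ℝ => x ^ (-α) * exp (-(ε * x)))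
      (-((α * x ^ (-1 - α) + ε * x ^ (-α)) * exp (-(ε * x)))) x := by
  have h1 := hasDerivAt_rpow_const (x := x) (p := -α) (Or.inl hx.ne')
  have h2 : HasDerivAt (fun x : ℝ => exp (-(ε * x))) (exp (-(ε * x)) * -(ε * 1)) x :=
    (((hasDerivAt_id x).const_mul ε).neg).exp
  refine (h1.mul h2).congr_deriv ?_
  rw [show -1 - α = -α - 1 by ring]
  ring

theorem tempered_deriv_le {α ε x : ℝ} (hα0 : 0 < α) (hε : 0 ≤ ε) (hx : 0 < x) :
    (α * x ^ (-1 - α) + ε * x ^ (-α)) * exp (-(ε * x)) ≤ (α + 1) * x ^ (-1 - α) := by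
  have h1 : x ^ (-α) = x * x ^ (-1 - α) := by
    rw [← rpow_one_add' hx.le (by linarith)]
    ring_nf
  have h2 : exp (-(ε * x)) ≤ 1 := exp_le_one_iff.2 (by nlinarith)
  have h3 : ε * x * exp (-(ε * x)) ≤ 1 := by
    rw [exp_neg, ← div_eq_mul_inv, div_le_one (exp_pos _)]
    linarith [add_one_le_exp (ε * x)]
  have h4 : (α + ε * x) * exp (-(ε * x)) ≤ α + 1 := by nlinarith
  rw [h1]
  calc _ = (α + ε * x) * exp (-(ε * x)) * x ^ (-1 - α) := by ring
    _ ≤ _ := by gcongr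

/-- Convolution of an integrable kernel is self-adjoint up to reflection. -/
theorem integral_mul_convolution_swap {f k g : ℝ → ℝ} (hf : Continuous f) {C : ℝ}
    (hfC : ∀ x, |f x| ≤ C) (hk : Integrable k) (hg : Integrable g) :
    ∫ s, f s * ∫ u, k u * g (s - u) = ∫ u, k u * ∫ s, f s * g (s - u) := by
  have h1 := hk.convolution_integrand (ContinuousLinearMap.mul ℝ ℝ) hg
  have h2 : Integrable (fun p : ℝ × ℝ => f p.1 * (k p.2 * g (p.1 - p.2))) :=
    h1.bdd_mul (c := C) (hf.comp continuous_fst).aestronglyMeasurable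
      (.of_forall fun p => hfC p.1)
  have := integral_integral_swap (f := fun s u => f s * (k u * g (s - u))) h2
  simp only [← integral_const_mul]
  rw [this]
  congr 1; ext u; congr 1; ext s; ring

/-- The correlation `h ↦ ∫ f(t) g(h + t) dt`. -/
noncomputable def correlation (f g : ℝ → ℝ) (h : ℝ) : ℝ := ∫ t, f t * g (h + t)

theorem correlation_eq_convolution (f g : ℝ → ℝ) :
    correlation f g = convolution (fun t => f (-t)) g (ContinuousLinearMap.mul ℝ ℝ) volume := by
  ext h
  rw [convolution_def, correlation, ← integral_neg_eq_self]
  simp [sub_eq_add_neg]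

theorem continuous_correlation {f g : ℝ → ℝ} (hf : Continuous f)
    (hg : Continuous g) (hgs : HasCompactSupport g) : Continuous (correlation f g) := by
  rw [correlation_eq_convolution]
  exact hgs.continuous_convolution_right _ (by fun_prop : Continuous fun t => f (-t)).locallyIntegrable hg

theorem hasCompactSupport_correlation {f g : ℝ → ℝ} (hfs : HasCompactSupport f)
    (hgs : HasCompactSupport g) : HasCompactSupport (correlation f g) := by
  rw [correlation_eq_convolution]
  exact HasCompactSupport.convolution _ (hfs.comp_homeomorph (Homeomorph.neg ℝ)) hgs

theorem hasDerivAt_correlation {f g : ℝ → ℝ} (hf : Continuous f)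
    (hg : ContDiff ℝ 1 g) (hgs : HasCompactSupport g) (h : ℝ) :
    HasDerivAt (correlation f g) (correlation f (deriv g) h) h := by
  rw [correlation_eq_convolution, correlation_eq_convolution]
  exact hgs.hasDerivAt_convolution_right _
    (by fun_prop : Continuous fun t => f (-t)).locallyIntegrable hg h

theorem correlation_deriv_self_zero {w : ℝ → ℝ} (hw : ContDiff ℝ 1 w) (hws : HasCompactSupport w) :
    correlation (deriv w) w 0 = 0 := by
  have hd : ∀ x, HasDerivAt w (deriv w x) x := fun x =>
    (hw.differentiable one_ne_zero x).hasDerivAt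
  have hw' := hw.continuous_deriv le_rfl
  have := integral_eq_zero_of_hasDerivAt_of_integrable (f := fun x => w x * w x)
    (f' := fun x => deriv w x * w x + w x * deriv w x) (fun x => (hd x).mul (hd x))
    (Continuous.integrable_of_hasCompactSupport (μ := volume)
      (by have := hw.continuous; fun_prop) (hws.mul_left.add hws.mul_right))
    (Continuous.integrable_of_hasCompactSupport (μ := volume)
      (by have := hw.continuous; fun_prop) hws.mul_left)
  unfold correlation
  have h2 : (fun x => deriv w x * w x + w x * deriv w x) = fun x => 2 * (deriv w x * w (0 + x)) := by
    ext x; simp; ring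
  rw [h2, integral_const_mul] at this
  linarith

theorem correlation_self_neg (g : ℝ → ℝ) (h : ℝ) : correlation g g (-h) = correlation g g h := by
  unfold correlation
  rw [← integral_add_left_eq_self _ h]
  simp [mul_comm]

theorem integral_mul_comp_sub (f g : ℝ → ℝ) (u : ℝ) :
    ∫ s, f s * g (s - u) = correlation g f u := by
  unfold correlation
  rw [← integral_add_left_eq_self _ u]
  simp [mul_comm]

theorem integral_sq_convolution {k g : ℝ → ℝ} (hk : Integrable k) (hg : Continuous g)
    (hgs : HasCompactSupport g) :
    ∫ s, (∫ u, k u * g (s - u)) ^ 2 = ∫ u, k u * ∫ x, k x * correlation g g (x - u) := by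
  obtain ⟨C, hC⟩ := hgs.exists_bound_of_continuous hg
  have hgi : Integrable g := hg.integrable_of_hasCompactSupport hgs
  have hcont : Continuous fun s => ∫ u, k u * g (s - u) :=
    hgs.continuous_convolution_right (ContinuousLinearMap.mul ℝ ℝ) hk.locallyIntegrable hg
  have hbd : ∀ s, |∫ u, k u * g (s - u)| ≤ ∫ u, |k u| * C := fun s => by
    rw [← norm_eq_abs]
    refine norm_integral_le_of_norm_le (hk.abs.mul_const C) (.of_forall fun u => ?_)
    rw [norm_mul]
    exact mul_le_mul_of_nonneg_left (hC _) (abs_nonneg _)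
  simp only [pow_two]
  rw [integral_mul_convolution_swap hcont hbd hk hgi]
  congr 1; ext u; congr 1
  have := integral_mul_convolution_swap (f := fun s => g (s - u)) (by fun_prop) (C := C)
    (fun x => hC _) hk hgi
  simp_rw [mul_comm _ (g (_ - u))]
  rw [this]
  congr 1; ext x; congr 1
  unfold correlation
  rw [← integral_add_left_eq_self _ x]
  congr 1; ext t
  ring_nf

theorem integral_symmetric_kernel {k R : ℝ → ℝ} (hk : Integrable k) (hR : Continuous R) {C : ℝ}
    (hRC : ∀ x, |R x| ≤ C) (heven : ∀ x, R (-x) = R x) :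
    ∫ u, k u * ∫ x, k x * R (x - u)
      = 2 * ∫ u, k u * ∫ x in Set.Ioi u, k x * R (x - u) := by
  set F : ℝ → ℝ → ℝ := fun u x => k u * (k x * R (x - u)) with hF
  have hint : Integrable (Function.uncurry F) (volume.prod volume) := by
    have h := (hk.mul_prod hk).bdd_mul (c := C) (f := fun p : ℝ × ℝ => R (p.2 - p.1))
      (by fun_prop : Continuous fun p : ℝ × ℝ => R (p.2 - p.1)).aestronglyMeasurable
      (.of_forall fun p => hRC _)
    refine h.congr (.of_forall fun p => ?_)
    simp only [hF, Function.uncurry]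
    ring
  have hsymm : ∀ u x, F u x = F x u := fun u x => by
    simp only [hF]
    rw [show x - u = -(u - x) by ring, heven]
    ring
  have hS : MeasurableSet {p : ℝ × ℝ | p.1 < p.2} := measurableSet_lt measurable_fst measurable_snd
  have hT : MeasurableSet {p : ℝ × ℝ | p.2 ≤ p.1} := measurableSet_le measurable_snd measurable_fst
  have e1 : ∀ u, ∫ x in Set.Ioi u, F u x
      = ∫ x, ({p : ℝ × ℝ | p.1 < p.2}.indicator (Function.uncurry F)) (u, x) := fun u => by
    rw [← integral_indicator measurableSet_Ioi]
    rfl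
  have e2 : ∀ u, ∫ x in Set.Iic u, F u x
      = ∫ x, ({p : ℝ × ℝ | p.2 ≤ p.1}.indicator (Function.uncurry F)) (u, x) := fun u => by
    rw [← integral_indicator measurableSet_Iic]
    rfl
  have e3 : ∀ x, ∫ u, ({p : ℝ × ℝ | p.2 ≤ p.1}.indicator (Function.uncurry F)) (u, x)
      = ∫ u in Set.Ioi x, F x u := fun x => by
    rw [← integral_Ici_eq_integral_Ioi, ← integral_indicator measurableSet_Ici]
    congr 1; ext u
    simp only [Set.indicator_apply, Set.mem_ofPred_eq, Set.mem_Ici, Function.uncurry, hsymm u x]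
  have hi1 := hint.indicator hS
  have hi2 := hint.indicator hT
  have hsplit : ∀ᵐ u, ∫ x, F u x = (∫ x in Set.Iic u, F u x) + ∫ x in Set.Ioi u, F u x := by
    filter_upwards [hint.prod_right_ae] with u hu
    rw [← Set.compl_Iic]
    exact (integral_add_compl measurableSet_Iic hu).symm
  have hswap := integral_integral_swap
    (f := fun u x => ({p : ℝ × ℝ | p.2 ≤ p.1}.indicator (Function.uncurry F)) (u, x)) hi2
  have l1 : ∀ u, k u * ∫ x, k x * R (x - u) = ∫ x, F u x := fun u =>
    (integral_const_mul _ _).symm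
  have l2 : ∀ u, k u * ∫ x in Set.Ioi u, k x * R (x - u) = ∫ x in Set.Ioi u, F u x := fun u =>
    (integral_const_mul _ _).symm
  simp only [l1, l2]
  rw [integral_congr_ae hsplit, integral_add, two_mul]
  · congr 1
    simp only [e2]
    rw [hswap]
    simp only [e3]
  · simp only [e2]; exact hi2.integral_prod_left
  · simp only [e1]; exact hi1.integral_prod_left

theorem setIntegral_Ioi_shift (f : ℝ → ℝ) (u : ℝ) :
    ∫ x in Set.Ioi u, f x = ∫ h in Set.Ioi (0 : ℝ), f (u + h) := by
  rw [← integral_indicator measurableSet_Ioi, ← integral_indicator measurableSet_Ioi,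
    ← integral_add_left_eq_self _ u]
  congr 1; ext h
  simp [Set.indicator_apply]

theorem integral_tempered_mul_deriv {α ε u : ℝ} (hα0 : 0 < α) (hε : 0 ≤ ε) (hu : 0 < u)
    {Q R : ℝ → ℝ} (hQ : ∀ h, HasDerivAt Q (R h) h) (hQ0 : Q 0 = 0) (hQs : HasCompactSupport Q)
    (hR : Integrable R) :
    ∫ h in Set.Ioi (0 : ℝ), (u + h) ^ (-α) * exp (-(ε * (u + h))) * R h
      = ∫ h in Set.Ioi (0 : ℝ), (α * (u + h) ^ (-1 - α) + ε * (u + h) ^ (-α))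
          * exp (-(ε * (u + h))) * Q h := by
  have hQc : Continuous Q := continuous_iff_continuousAt.2 fun h => (hQ h).continuousAt
  have hd : ∀ h : ℝ, 0 ≤ h → HasDerivAt (fun h : ℝ => (u + h) ^ (-α) * exp (-(ε * (u + h))))
      (-((α * (u + h) ^ (-1 - α) + ε * (u + h) ^ (-α)) * exp (-(ε * (u + h))))) h := fun h hh =>
    (hasDerivAt_rpow_mul_exp α ε (by linarith : 0 < u + h)).comp_const_add u h
  have hexp : ∀ h : ℝ, 0 < h → exp (-(ε * (u + h))) ≤ 1 := fun h hh =>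
    exp_le_one_iff.2 (by nlinarith)
  have i1 : IntegrableOn (fun h => (u + h) ^ (-α) * exp (-(ε * (u + h))) * R h) (Set.Ioi 0) := by
    refine Integrable.bdd_mul (c := u ^ (-α)) hR.integrableOn
      (Measurable.aestronglyMeasurable (by fun_prop))
      ((ae_restrict_iff' measurableSet_Ioi).2 (.of_forall fun h hh => ?_))
    have hh : 0 < h := hh
    rw [norm_of_nonneg (by positivity)]
    calc _ ≤ u ^ (-α) * 1 := mul_le_mul
          (rpow_le_rpow_of_nonpos hu (by linarith) (by linarith)) (hexp h hh) (by positivity)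
          (by positivity)
      _ = _ := mul_one _
  have i2 : IntegrableOn (fun h => (α * (u + h) ^ (-1 - α) + ε * (u + h) ^ (-α))
      * exp (-(ε * (u + h))) * Q h) (Set.Ioi 0) := by
    refine Integrable.bdd_mul (c := (α + 1) * u ^ (-1 - α))
      (hQc.integrable_of_hasCompactSupport hQs).integrableOn
      (Measurable.aestronglyMeasurable (by fun_prop))
      ((ae_restrict_iff' measurableSet_Ioi).2 (.of_forall fun h hh => ?_))
    have hh : 0 < h := hh
    rw [norm_of_nonneg (by positivity)]
    refine (tempered_deriv_le hα0 hε (by linarith)).trans ?_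
    exact mul_le_mul_of_nonneg_left
      (rpow_le_rpow_of_nonpos hu (by linarith) (by linarith)) (by linarith)
  have hQtop : ∀ᶠ h in Filter.atTop, Q h = 0 :=
    (hasCompactSupport_iff_eventuallyEq.1 hQs).filter_mono
      (by rw [Filter.coclosedCompact_eq_cocompact]; exact atTop_le_cocompact)
  have key := integral_Ioi_mul_deriv_eq_deriv_mul (a := 0) (a' := 0) (b' := 0)
    (fun h hh => hd h (le_of_lt hh)) (fun h _ => hQ h) i1
    (by
      refine i2.neg.congr (.of_forall fun h => ?_)
      simp only [Pi.neg_apply, Pi.mul_apply]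
      ring)
    (by
      have := ((hd 0 le_rfl).continuousAt.mul hQc.continuousAt).tendsto
      simp only [Pi.mul_apply, hQ0, mul_zero] at this
      exact this.mono_left nhdsWithin_le_nhds)
    (by
      refine tendsto_const_nhds.congr' ?_
      filter_upwards [hQtop] with h hh
      simp [hh])
  rw [key, sub_self, zero_sub, ← integral_neg]
  congr 1; ext h; ring

theorem integral_temperedKernel_eq {α ε : ℝ} (f : ℝ → ℝ) :
    ∫ u, temperedKernel α ε u * f u
      = ∫ u in Set.Ioi (0 : ℝ), u ^ (-α) * exp (-(ε * u)) * f u := by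
  rw [← integral_indicator measurableSet_Ioi]
  congr 1; ext u
  simp only [temperedKernel, Set.indicator_apply]
  split_ifs <;> simp

theorem integral_sq_tempered_convolution {α ε : ℝ} (hα0 : 0 < α) (hα1 : α < 1) (hε : 0 < ε)
    {w : ℝ → ℝ} (hw : ContDiff ℝ 1 w) (hws : HasCompactSupport w) :
    ∫ s, (∫ x, temperedKernel α ε x * deriv w (s - x)) ^ 2
      = 2 * ∫ u in Set.Ioi (0 : ℝ), ∫ h in Set.Ioi (0 : ℝ), u ^ (-α) * exp (-(ε * u)) *
        ((α * (u + h) ^ (-1 - α) + ε * (u + h) ^ (-α)) * exp (-(ε * (u + h)))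
          * correlation (deriv w) w h) := by
  have hw' := hw.continuous_deriv le_rfl
  have hRc := continuous_correlation hw' hw' hws.deriv
  have hRs := hasCompactSupport_correlation hws.deriv hws.deriv
  obtain ⟨C, hC⟩ := hRs.exists_bound_of_continuous hRc
  rw [integral_sq_convolution (integrable_temperedKernel hα1 hε) hw' hws.deriv,
    integral_symmetric_kernel (integrable_temperedKernel hα1 hε) hRc hC (correlation_self_neg _),
    integral_temperedKernel_eq]
  congr 1
  refine setIntegral_congr_fun measurableSet_Ioi fun u hu => ?_
  rw [integral_const_mul, setIntegral_Ioi_shift, ← integral_tempered_mul_deriv hα0 hε.le hu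
    (hasDerivAt_correlation hw' hw hws) (correlation_deriv_self_zero hw hws)
    (hasCompactSupport_correlation hws.deriv hws) (hRc.integrable_of_hasCompactSupport hRs)]
  congr 1
  refine setIntegral_congr_fun measurableSet_Ioi fun h hh => ?_
  have hu : 0 < u := hu
  have hh : 0 < h := hh
  rw [temperedKernel_of_pos (by linarith), add_sub_cancel_left]

theorem exists_radius_of_hasCompactSupport {w : ℝ → ℝ} (hws : HasCompactSupport w) :
    ∃ B : ℝ, 0 < B ∧ (∀ x, B ≤ |x| → w x = 0) ∧ ∀ x, B ≤ |x| → deriv w x = 0 := by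
  obtain ⟨B, hB0, hB⟩ := hws.isCompact.isBounded.subset_ball_lt 0 0
  have hout : ∀ x, B ≤ |x| → x ∉ tsupport w := fun x hx h => by
    have := hB h
    rw [mem_ball_zero_iff, norm_eq_abs] at this
    linarith
  exact ⟨B, hB0, fun x hx => image_eq_zero_of_notMem_tsupport (hout x hx), fun x hx => by
    by_contra hne
    exact hout x hx (support_deriv_subset hne)⟩

theorem exists_bound_sq_tempered_convolution {α : ℝ} (hα0 : 0 < α) (hα1 : α < 1) {w : ℝ → ℝ}
    (hw : ContDiff ℝ 1 w) (hws : HasCompactSupport w) :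
    ∃ C, ∀ ε, 0 ≤ ε → ∀ s,
      (∫ x, temperedKernel α ε x * deriv w (s - x)) ^ 2 ≤ C * (1 + s ^ 2)⁻¹ := by
  obtain ⟨B, hB0, hwB, hgB⟩ := exists_radius_of_hasCompactSupport hws
  have hw' := hw.continuous_deriv le_rfl
  obtain ⟨N, hN⟩ := hws.exists_bound_of_continuous hw.continuous
  obtain ⟨M, hM⟩ := hws.deriv.exists_bound_of_continuous hw'
  have hN0 : 0 ≤ N := (norm_nonneg _).trans (hN 0)
  have hM0 : 0 ≤ M := (norm_nonneg _).trans (hM 0)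
  set I := ∫ x, (Set.Icc 0 (3 * B + 1)).indicator (temperedKernel α 0) x * M with hI
  set D := (α + 1) * N * (2 * B) with hD
  have hD0 : 0 ≤ D := by positivity
  refine ⟨I ^ 2 * (1 + (2 * B + 1) ^ 2) + 8 * D ^ 2, fun ε hε s => ?_⟩
  rw [← div_eq_mul_inv, le_div_iff₀ (by positivity)]
  rcases le_or_gt s (-(2 * B + 1)) with hs | hs
  · have : ∀ x, temperedKernel α ε x * deriv w (s - x) = 0 := fun x => by
      rcases le_or_gt x 0 with hx | hx
      · rw [temperedKernel_of_nonpos hx, zero_mul]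
      · rw [hgB _ (by rw [abs_of_neg] <;> linarith), mul_zero]
    simp only [this, integral_zero]
    have : 0 ≤ I ^ 2 * (1 + (2 * B + 1) ^ 2) + 8 * D ^ 2 := by positivity
    simpa using this
  rcases le_or_gt s (2 * B + 1) with hs2 | hs2
  · have hK : |∫ x, temperedKernel α ε x * deriv w (s - x)| ≤ I := by
      rw [← norm_eq_abs]
      refine norm_integral_le_of_norm_le
        (((integrableOn_temperedKernel_zero hα1 0 (3 * B + 1)).integrable_indicator
          measurableSet_Icc).mul_const M) (.of_forall fun x => ?_)
      rw [norm_mul, norm_of_nonneg (temperedKernel_nonneg _ _ _)]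
      by_cases hx : x ∈ Set.Icc 0 (3 * B + 1)
      · rw [Set.indicator_of_mem hx]
        exact mul_le_mul (temperedKernel_le hε x) (hM _) (norm_nonneg _)
          (temperedKernel_nonneg _ _ _)
      · rw [Set.indicator_of_notMem hx, zero_mul]
        rcases le_or_gt x 0 with hx0 | hx0
        · rw [temperedKernel_of_nonpos hx0, zero_mul]
        · have : 3 * B + 1 < x := not_le.1 fun h => hx ⟨hx0.le, h⟩
          rw [hgB _ (by rw [abs_of_neg] <;> linarith), norm_zero, mul_zero]
    have h1 : (∫ x, temperedKernel α ε x * deriv w (s - x)) ^ 2 ≤ I ^ 2 :=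
      sq_le_sq' (by linarith [neg_abs_le (∫ x, temperedKernel α ε x * deriv w (s - x))])
        ((le_abs_self _).trans hK)
    have h2 : s ^ 2 ≤ (2 * B + 1) ^ 2 := sq_le_sq' hs.le hs2
    calc _ ≤ I ^ 2 * (1 + (2 * B + 1) ^ 2) := by gcongr
      _ ≤ _ := by linarith [mul_nonneg (by norm_num : (0 : ℝ) ≤ 8) (sq_nonneg D)]
  · have hsB : ∀ y ∈ Set.uIcc (-B) B, 0 < s - y ∧ s - B ≤ s - y := fun y hy => by
      rw [Set.uIcc_of_le (by linarith)] at hy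
      exact ⟨by linarith [hy.2], by linarith [hy.2]⟩
    have e1 : ∫ x, temperedKernel α ε x * deriv w (s - x)
        = ∫ y in (-B)..B, (s - y) ^ (-α) * exp (-(ε * (s - y))) * deriv w y := by
      rw [← integral_sub_left_eq_self _ _ s, intervalIntegral.integral_of_le (by linarith),
        ← integral_indicator measurableSet_Ioc]
      congr 1; ext y
      rw [sub_sub_cancel]
      by_cases hy : y ∈ Set.Ioc (-B) B
      · rw [Set.indicator_of_mem hy, temperedKernel_of_pos (by linarith [hy.2])]
      · rw [Set.indicator_of_notMem hy, hgB y, mul_zero]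
        by_contra hlt
        rw [not_le, abs_lt] at hlt
        exact hy ⟨hlt.1, hlt.2.le⟩
    have hder : ∀ y ∈ Set.uIcc (-B) B, HasDerivAt
        (fun y : ℝ => (s - y) ^ (-α) * exp (-(ε * (s - y))))
        ((α * (s - y) ^ (-1 - α) + ε * (s - y) ^ (-α)) * exp (-(ε * (s - y)))) y := fun y hy => by
      refine ((hasDerivAt_rpow_mul_exp α ε (hsB y hy).1).comp_const_sub s y).congr_deriv ?_
      ring
    have hcont : ContinuousOn (fun y : ℝ =>
        (α * (s - y) ^ (-1 - α) + ε * (s - y) ^ (-α)) * exp (-(ε * (s - y))))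
        (Set.uIcc (-B) B) := by
      have h1 : ∀ p : ℝ, ContinuousOn (fun y : ℝ => (s - y) ^ p) (Set.uIcc (-B) B) := fun p =>
        (continuous_const.sub continuous_id).continuousOn.rpow_const
          fun y hy => Or.inl (hsB y hy).1.ne'
      exact (((h1 _).const_mul _).add ((h1 _).const_mul _)).mul (by fun_prop)
    have e2 := intervalIntegral.integral_mul_deriv_eq_deriv_mul hder
      (fun y _ => (hw.differentiable one_ne_zero y).hasDerivAt) hcont.intervalIntegrable
      (hw'.intervalIntegrable _ _)
    rw [hwB B (le_abs_self B), hwB (-B) (by rw [abs_neg]; exact le_abs_self B), mul_zero, mul_zero,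
      sub_self, zero_sub] at e2
    have hb : ∀ y ∈ Set.uIoc (-B) B,
        ‖(α * (s - y) ^ (-1 - α) + ε * (s - y) ^ (-α)) * exp (-(ε * (s - y))) * w y‖
          ≤ (α + 1) * (s - B)⁻¹ * N := fun y hy => by
      obtain ⟨h1, h2⟩ := hsB y (Set.uIoc_subset_uIcc hy)
      rw [norm_mul, norm_of_nonneg (by positivity)]
      refine mul_le_mul ?_ (hN y) (norm_nonneg _) (by
        have : 0 < s - B := by linarith
        positivity)
      refine (tempered_deriv_le hα0 hε h1).trans (mul_le_mul_of_nonneg_left ?_ (by linarith))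
      calc (s - y) ^ (-1 - α) ≤ (s - B) ^ (-1 - α) :=
            rpow_le_rpow_of_nonpos (by linarith) h2 (by linarith)
        _ ≤ (s - B) ^ (-1 : ℝ) := rpow_le_rpow_of_exponent_le (by linarith) (by linarith)
        _ = _ := rpow_neg_one _
    have e3 := intervalIntegral.norm_integral_le_of_norm_le_const hb
    rw [sub_neg_eq_add, abs_of_pos (by linarith), norm_eq_abs] at e3
    have e4 : |∫ x, temperedKernel α ε x * deriv w (s - x)| ≤ D * (2 / s) := by
      rw [e1, e2, abs_neg]
      refine e3.trans ?_
      have : (s - B)⁻¹ ≤ 2 / s := by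
        rw [inv_le_comm₀ (by linarith) (by apply div_pos <;> linarith), inv_div]
        linarith
      calc _ = D * (s - B)⁻¹ := by rw [hD]; ring
        _ ≤ _ := by gcongr
    have e5 : (∫ x, temperedKernel α ε x * deriv w (s - x)) ^ 2 ≤ (D * (2 / s)) ^ 2 := by
      rw [← sq_abs]
      exact pow_le_pow_left₀ (abs_nonneg _) e4 2
    have hs0 : 0 < s := by linarith
    calc _ ≤ (D * (2 / s)) ^ 2 * (1 + s ^ 2) := by gcongr
      _ = D ^ 2 * (4 / s ^ 2 + 4) := by field_simp; ring
      _ ≤ D ^ 2 * 8 := by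
        gcongr
        have : 4 / s ^ 2 ≤ 4 := by
          rw [div_le_iff₀ (by positivity)]
          nlinarith
        linarith
      _ ≤ _ := by
        have : 0 ≤ I ^ 2 * (1 + (2 * B + 1) ^ 2) := by positivity
        linarith

theorem continuous_temperedKernel_convolution {α ε : ℝ} (hα1 : α < 1) (hε : 0 ≤ ε) {g : ℝ → ℝ}
    (hg : Continuous g) (hgs : HasCompactSupport g) :
    Continuous fun s => ∫ x, temperedKernel α ε x * g (s - x) :=
  hgs.continuous_convolution_right (ContinuousLinearMap.mul ℝ ℝ)
    (locallyIntegrable_temperedKernel hα1 hε) hg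

theorem tendsto_temperedKernel (α x : ℝ) :
    Filter.Tendsto (fun ε => temperedKernel α ε x) (nhdsWithin 0 (Set.Ioi 0))
      (nhds (temperedKernel α 0 x)) := by
  have : Continuous fun ε => temperedKernel α ε x := by
    rcases le_or_gt x 0 with hx | hx
    · simp only [temperedKernel_of_nonpos hx]
      fun_prop
    · simp only [temperedKernel_of_pos hx]
      fun_prop
  exact (this.tendsto 0).mono_left nhdsWithin_le_nhds

theorem integrable_temperedKernel_mul {α ε : ℝ} (hα1 : α < 1) (hε : 0 ≤ ε) {g : ℝ → ℝ}
    (hg : Continuous g) (hgs : HasCompactSupport g) :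
    Integrable fun x => temperedKernel α ε x * g x :=
  (locallyIntegrable_temperedKernel hα1 hε).integrable_smul_right_of_hasCompactSupport hg hgs

theorem hasCompactSupport_comp_sub {g : ℝ → ℝ} (hgs : HasCompactSupport g) (s : ℝ) :
    HasCompactSupport fun x => g (s - x) :=
  hgs.comp_homeomorph (Homeomorph.subLeft s)

theorem tendsto_integral_sq_tempered_convolution {α : ℝ} (hα0 : 0 < α) (hα1 : α < 1) {w : ℝ → ℝ}
    (hw : ContDiff ℝ 1 w) (hws : HasCompactSupport w) :
    Filter.Tendsto (fun ε => ∫ s, (∫ x, temperedKernel α ε x * deriv w (s - x)) ^ 2)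
      (nhdsWithin 0 (Set.Ioi 0))
      (nhds (∫ s, (∫ x, temperedKernel α 0 x * deriv w (s - x)) ^ 2)) := by
  have hw' := hw.continuous_deriv le_rfl
  obtain ⟨C, hC⟩ := exists_bound_sq_tempered_convolution hα0 hα1 hw hws
  refine tendsto_integral_filter_of_dominated_convergence (fun s => C * (1 + s ^ 2)⁻¹) ?_ ?_
    (integrable_inv_one_add_sq.const_mul C) ?_
  · filter_upwards [self_mem_nhdsWithin] with ε hε
    exact ((continuous_temperedKernel_convolution hα1 (le_of_lt hε) hw'
      hws.deriv).pow 2).aestronglyMeasurable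
  · filter_upwards [self_mem_nhdsWithin] with ε hε
    refine .of_forall fun s => ?_
    rw [norm_of_nonneg (sq_nonneg _)]
    exact hC ε (le_of_lt hε) s
  · refine .of_forall fun s => Filter.Tendsto.pow ?_ 2
    have hgc : Continuous fun x => deriv w (s - x) := by fun_prop
    refine tendsto_integral_filter_of_dominated_convergence
      (fun x => |temperedKernel α 0 x * deriv w (s - x)|) ?_ ?_
      (integrable_temperedKernel_mul hα1 le_rfl hgc
        (hasCompactSupport_comp_sub hws.deriv s)).abs ?_
    · exact .of_forall fun ε => ((measurable_temperedKernel α ε).mul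
        hgc.measurable).aestronglyMeasurable
    · filter_upwards [self_mem_nhdsWithin] with ε hε
      refine .of_forall fun x => ?_
      rw [norm_mul, abs_mul, norm_of_nonneg (temperedKernel_nonneg _ _ _),
        abs_of_nonneg (temperedKernel_nonneg _ _ _)]
      exact mul_le_mul_of_nonneg_right (temperedKernel_le (le_of_lt hε) x) (abs_nonneg _)
    · exact .of_forall fun x => (tendsto_temperedKernel α x).mul_const _

theorem integrable_prod_kernel_mul {α : ℝ} (hα0 : 0 < α) (hα1 : α < 1 / 2) {Q : ℝ → ℝ}
    (hQ : Continuous Q) (hQs : HasCompactSupport Q) :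
    Integrable (fun p : ℝ × ℝ => p.1 ^ (-α) * (p.1 + p.2) ^ (-1 - α) * Q p.2)
      ((volume.restrict (Set.Ioi 0)).prod (volume.restrict (Set.Ioi 0))) := by
  have hmeas : Measurable (fun p : ℝ × ℝ => p.1 ^ (-α) * (p.1 + p.2) ^ (-1 - α) * Q p.2) := by
    have := hQ.measurable
    fun_prop
  rw [integrable_prod_iff' hmeas.aestronglyMeasurable]
  refine ⟨(ae_restrict_iff' measurableSet_Ioi).2 (.of_forall fun h hh =>
    (integrableOn_rpow_mul_add_rpow hα0 (by linarith) hh).mul_const (Q h)), ?_⟩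
  have hi := ((integrable_temperedKernel_mul (α := 2 * α) (by linarith) le_rfl hQ hQs).abs.const_mul
    (Gamma (1 - α) * Gamma (2 * α) / Gamma (1 + α))).integrableOn (s := Set.Ioi 0)
  refine IntegrableOn.congr_fun hi (fun h hh => ?_) measurableSet_Ioi
  have hh : 0 < h := hh
  have : ∫ u in Set.Ioi (0 : ℝ), ‖u ^ (-α) * (u + h) ^ (-1 - α) * Q h‖
      = ∫ u in Set.Ioi (0 : ℝ), u ^ (-α) * (u + h) ^ (-1 - α) * |Q h| := by
    refine setIntegral_congr_fun measurableSet_Ioi fun u hu => ?_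
    have hu : 0 < u := hu
    rw [norm_mul, norm_of_nonneg (by positivity), norm_eq_abs]
  simp only
  rw [this, integral_mul_const, integral_rpow_mul_add_rpow hα0 (by linarith) hh, abs_mul,
    abs_of_nonneg (temperedKernel_nonneg _ _ _), temperedKernel_of_pos hh]
  simp only [zero_mul, neg_zero, exp_zero, mul_one]
  ring

theorem tendsto_integral_integral_tempered {α : ℝ} (hα0 : 0 < α) (hα1 : α < 1 / 2) {Q : ℝ → ℝ}
    (hQ : Continuous Q) (hQs : HasCompactSupport Q) :
    Filter.Tendsto (fun ε => ∫ u in Set.Ioi (0 : ℝ), ∫ h in Set.Ioi (0 : ℝ),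
        u ^ (-α) * exp (-(ε * u)) *
        ((α * (u + h) ^ (-1 - α) + ε * (u + h) ^ (-α)) * exp (-(ε * (u + h))) * Q h))
      (nhdsWithin 0 (Set.Ioi 0))
      (nhds (α * (Gamma (1 - α) * Gamma (2 * α) / Gamma (1 + α)) *
        ∫ h in Set.Ioi (0 : ℝ), h ^ (-(2 * α)) * Q h)) := by
  set μ := volume.restrict (Set.Ioi (0 : ℝ)) with hμ
  set Φ : ℝ → ℝ × ℝ → ℝ := fun ε p => p.1 ^ (-α) * exp (-(ε * p.1)) *
        ((α * (p.1 + p.2) ^ (-1 - α) + ε * (p.1 + p.2) ^ (-α)) * exp (-(ε * (p.1 + p.2)))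
          * Q p.2) with hΦ
  have hbase := integrable_prod_kernel_mul hα0 hα1 hQ hQs
  have hQm := hQ.measurable
  have hmeas : ∀ ε, AEStronglyMeasurable (Φ ε) (μ.prod μ) := fun ε =>
    (by fun_prop : Measurable (Φ ε)).aestronglyMeasurable
  have hpos : ∀ᵐ p ∂(μ.prod μ), 0 < p.1 ∧ 0 < p.2 := by
    rw [hμ, Measure.prod_restrict]
    exact (ae_restrict_iff' (measurableSet_Ioi.prod measurableSet_Ioi)).2 (.of_forall fun p hp => hp)
  have hbound : ∀ ε, 0 < ε → ∀ᵐ p ∂(μ.prod μ), ‖Φ ε p‖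
      ≤ (α + 1) * |p.1 ^ (-α) * (p.1 + p.2) ^ (-1 - α) * Q p.2| := fun ε hε => by
    filter_upwards [hpos] with p ⟨h1, h2⟩
    have hexp : exp (-(ε * p.1)) ≤ 1 := exp_le_one_iff.2 (by nlinarith)
    have h3 := tempered_deriv_le hα0 hε.le (by linarith : 0 < p.1 + p.2)
    rw [norm_mul, norm_mul, norm_mul, norm_of_nonneg (by positivity : 0 ≤ p.1 ^ (-α)),
      norm_of_nonneg (exp_pos _).le, norm_of_nonneg (by positivity), abs_mul,
      abs_of_nonneg (by positivity), norm_eq_abs]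
    calc _ ≤ p.1 ^ (-α) * 1 * ((α + 1) * (p.1 + p.2) ^ (-1 - α) * |Q p.2|) := by gcongr
      _ = _ := by ring
  have hbi := hbase.abs.const_mul (α + 1)
  have hlim : Filter.Tendsto (fun ε => ∫ p, Φ ε p ∂(μ.prod μ)) (nhdsWithin 0 (Set.Ioi 0))
      (nhds (∫ p, Φ 0 p ∂(μ.prod μ))) := by
    refine tendsto_integral_filter_of_dominated_convergence _ (.of_forall hmeas) ?_ hbi ?_
    · filter_upwards [self_mem_nhdsWithin] with ε hε using hbound ε hε
    · refine .of_forall fun p => ?_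
      have : Continuous fun ε => Φ ε p := by fun_prop
      exact (this.tendsto 0).mono_left nhdsWithin_le_nhds
  have hzero : ∫ p, Φ 0 p ∂(μ.prod μ) = α * (Gamma (1 - α) * Gamma (2 * α) / Gamma (1 + α)) *
      ∫ h in Set.Ioi (0 : ℝ), h ^ (-(2 * α)) * Q h := by
    have e : Φ 0 = fun p => α * (p.1 ^ (-α) * (p.1 + p.2) ^ (-1 - α) * Q p.2) := by
      ext p
      simp only [hΦ, zero_mul, neg_zero, exp_zero, mul_one, add_zero]
      ring
    rw [e, integral_const_mul, integral_prod_symm _ hbase, mul_assoc]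
    congr 1
    rw [← integral_const_mul]
    refine setIntegral_congr_fun measurableSet_Ioi fun h hh => ?_
    simp only
    rw [integral_mul_const, integral_rpow_mul_add_rpow hα0 (by linarith) hh]
    ring
  rw [hzero] at hlim
  refine hlim.congr' ?_
  filter_upwards [self_mem_nhdsWithin] with ε hε
  exact integral_prod _ (hbi.mono' (hmeas ε) (hbound ε hε))

theorem integral_sq_power_convolution {α : ℝ} (hα0 : 0 < α) (hα1 : α < 1 / 2) {w : ℝ → ℝ}
    (hw : ContDiff ℝ 1 w) (hws : HasCompactSupport w) :
    ∫ s, (∫ x, temperedKernel α 0 x * deriv w (s - x)) ^ 2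
      = 2 * α * (Gamma (1 - α) * Gamma (2 * α) / Gamma (1 + α)) *
        ∫ h in Set.Ioi (0 : ℝ), h ^ (-(2 * α)) * correlation (deriv w) w h := by
  have hw' := hw.continuous_deriv le_rfl
  have h1 := tendsto_integral_sq_tempered_convolution hα0 (by linarith) hw hws
  have h2 := (tendsto_integral_integral_tempered hα0 hα1
    (continuous_correlation hw' hw.continuous hws)
    (hasCompactSupport_correlation hws.deriv hws)).const_mul 2
  refine (tendsto_nhds_unique_of_eventuallyEq h1 h2 ?_).trans (by ring)
  filter_upwards [self_mem_nhdsWithin] with ε hε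
  exact integral_sq_tempered_convolution hα0 (by linarith) hε hw hws

theorem integral_mul_power_convolution {β : ℝ} (hβ1 : β < 1) {w : ℝ → ℝ}
    (hw : ContDiff ℝ 1 w) (hws : HasCompactSupport w) :
    ∫ s, w s * ∫ x, temperedKernel β 0 x * deriv w (s - x)
      = ∫ h in Set.Ioi (0 : ℝ), h ^ (-β) * correlation (deriv w) w h := by
  obtain ⟨B, hB0, hwB, hgB⟩ := exists_radius_of_hasCompactSupport hws
  have hw' := hw.continuous_deriv le_rfl
  obtain ⟨N, hN⟩ := hws.exists_bound_of_continuous hw.continuous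
  set k := (Set.Icc 0 (2 * B)).indicator (temperedKernel β 0) with hk
  have hki : Integrable k :=
    (integrableOn_temperedKernel_zero hβ1 0 (2 * B)).integrable_indicator measurableSet_Icc
  have hvanish : ∀ s x, x ∉ Set.Icc 0 (2 * B) →
      temperedKernel β 0 x = 0 ∨ w s = 0 ∨ deriv w (s - x) = 0 := fun s x hx => by
    rcases le_or_gt x 0 with hx0 | hx0
    · exact Or.inl (temperedKernel_of_nonpos hx0)
    · have hx2 : 2 * B < x := not_le.1 fun h => hx ⟨hx0.le, h⟩
      by_cases hs : B ≤ |s|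
      · exact Or.inr (Or.inl (hwB s hs))
      · refine Or.inr (Or.inr (hgB _ ?_))
        have := (abs_lt.1 (not_le.1 hs)).2
        rw [abs_of_neg] <;> linarith
  have hL : ∀ s, w s * ∫ x, temperedKernel β 0 x * deriv w (s - x)
      = w s * ∫ x, k x * deriv w (s - x) := fun s => by
    simp only [← integral_const_mul]
    congr 1; ext x
    by_cases hx : x ∈ Set.Icc 0 (2 * B)
    · rw [hk, Set.indicator_of_mem hx]
    · rw [hk, Set.indicator_of_notMem hx]
      rcases hvanish s x hx with h | h | h <;> simp [h]
  have hR : ∀ x, k x * ∫ s, w s * deriv w (s - x)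
      = temperedKernel β 0 x * correlation (deriv w) w x := fun x => by
    rw [← integral_mul_comp_sub]
    by_cases hx : x ∈ Set.Icc 0 (2 * B)
    · rw [hk, Set.indicator_of_mem hx]
    · rw [hk, Set.indicator_of_notMem hx, zero_mul, ← integral_const_mul, eq_comm]
      refine integral_eq_zero_of_ae (.of_forall fun s => ?_)
      rcases hvanish s x hx with h | h | h <;> simp [h]
  simp only [hL]
  rw [integral_mul_convolution_swap hw.continuous hN hki
    (hw'.integrable_of_hasCompactSupport hws.deriv)]
  simp only [hR]
  rw [integral_temperedKernel_eq]
  simp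

/-- Coercivity identity for the Riemann–Liouville derivative on the line, with both sides expressed
through convolutions with the power kernel. -/
theorem power_convolution_coercivity {α : ℝ} (hα0 : 0 < α) (hα1 : α < 1 / 2) {w : ℝ → ℝ}
    (hw : ContDiff ℝ 1 w) (hws : HasCompactSupport w) :
    (Gamma (1 - 2 * α))⁻¹ * ∫ s, w s * ∫ x, temperedKernel (2 * α) 0 x * deriv w (s - x)
      = cos (π * α) * ((Gamma (1 - α))⁻¹ ^ 2 *
        ∫ s, (∫ x, temperedKernel α 0 x * deriv w (s - x)) ^ 2) := by
  rw [integral_mul_power_convolution (by linarith) hw hws,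
    integral_sq_power_convolution hα0 hα1 hw hws, gamma_constant hα0 hα1]
  ring

theorem setIntegral_image_Iio_comp {ψ : ℝ → ℝ} (hψ : Differentiable ℝ ψ) (hmono : StrictMono ψ)
    (hsurj : Function.Surjective ψ) (hψ' : ∀ t, 0 < deriv ψ t) (G : ℝ → ℝ) (τ : ℝ) :
    ∫ z in Set.Iio τ, deriv ψ z * G (ψ z) = ∫ y in Set.Iio (ψ τ), G y := by
  have himg : ψ '' Set.Iio τ = Set.Iio (ψ τ) := by
    ext y
    obtain ⟨x, rfl⟩ := hsurj y
    simp [hmono.injective.mem_set_image, hmono.lt_iff_lt]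
  rw [← himg, integral_image_eq_integral_abs_deriv_smul measurableSet_Iio
    (fun x _ => (hψ x).hasDerivAt.hasDerivWithinAt) hmono.injective.injOn]
  simp [abs_of_pos (hψ' _)]

theorem integral_deriv_mul_comp {ψ : ℝ → ℝ} (hψ : Differentiable ℝ ψ) (hmono : StrictMono ψ)
    (hsurj : Function.Surjective ψ) (hψ' : ∀ t, 0 < deriv ψ t) (G : ℝ → ℝ) :
    ∫ z, deriv ψ z * G (ψ z) = ∫ y, G y := by
  rw [← setIntegral_univ (f := G), ← hsurj.range_eq, ← Set.image_univ,
    integral_image_eq_integral_abs_deriv_smul MeasurableSet.univ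
    (fun x _ => (hψ x).hasDerivAt.hasDerivWithinAt) hmono.injective.injOn]
  simp [abs_of_pos (hψ' _)]

/-- A compactly supported `C¹` function is `w ∘ ψ` for a compactly supported `C¹` function `w`. -/
theorem exists_contDiff_comp_eq {ψ v : ℝ → ℝ} (hψ : ContDiff ℝ 1 ψ) (hmono : StrictMono ψ)
    (hsurj : Function.Surjective ψ) (hψ' : ∀ t, 0 < deriv ψ t) (hv : ContDiff ℝ 1 v)
    (hvs : HasCompactSupport v) :
    ∃ w : ℝ → ℝ, ContDiff ℝ 1 w ∧ HasCompactSupport w ∧ ∀ t, w (ψ t) = v t := by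
  set e := hmono.orderIsoOfSurjective ψ hsurj with he
  have hφc : Continuous e.symm := e.symm.continuous
  have hright : ∀ y, ψ (e.symm y) = y := fun y => e.apply_symm_apply y
  have hφ : ∀ y, HasDerivAt e.symm (deriv ψ (e.symm y))⁻¹ y := fun y =>
    HasDerivAt.of_local_left_inverse hφc.continuousAt
      (hψ.differentiable one_ne_zero _).hasDerivAt (hψ' _).ne' (.of_forall hright)
  have hw : ∀ y, HasDerivAt (fun y => v (e.symm y))
      (deriv v (e.symm y) * (deriv ψ (e.symm y))⁻¹) y := fun y =>
    (hv.differentiable one_ne_zero _).hasDerivAt.comp y (hφ y)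
  refine ⟨fun y => v (e.symm y), contDiff_one_iff_deriv.2 ⟨fun y => (hw y).differentiableAt, ?_⟩,
    hvs.comp_homeomorph e.symm.toHomeomorph, fun t => congrArg v (e.symm_apply_apply t)⟩
  rw [show deriv (fun y => v (e.symm y)) = fun y => deriv v (e.symm y) * (deriv ψ (e.symm y))⁻¹
    from funext fun y => (hw y).deriv]
  exact ((hv.continuous_deriv le_rfl).comp hφc).mul
    (((hψ.continuous_deriv le_rfl).comp hφc).inv₀ fun y => (hψ' _).ne')

theorem setIntegral_Iio_psi_kernel {ψ v w : ℝ → ℝ} (hψ : Differentiable ℝ ψ)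
    (hmono : StrictMono ψ) (hsurj : Function.Surjective ψ) (hψ' : ∀ t, 0 < deriv ψ t)
    (hwv : ∀ t, w (ψ t) = v t) (μ τ : ℝ) :
    ∫ z in Set.Iio τ, deriv ψ z * (ψ τ - ψ z) ^ (-μ) * v z
      = ∫ x, temperedKernel μ 0 x * w (ψ τ - x) := by
  have := setIntegral_image_Iio_comp hψ hmono hsurj hψ' (fun y => (ψ τ - y) ^ (-μ) * w y) τ
  simp only [hwv, ← mul_assoc] at this
  rw [this, ← integral_sub_left_eq_self (fun x => temperedKernel μ 0 x * w (ψ τ - x)) _ (ψ τ),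
    ← integral_indicator measurableSet_Iio]
  congr 1; ext y
  rw [sub_sub_cancel]
  by_cases hy : y < ψ τ
  · rw [Set.indicator_of_mem (Set.mem_Iio.2 hy), temperedKernel_of_pos (by linarith)]
    simp
  · rw [Set.indicator_of_notMem (by simpa using hy), temperedKernel_of_nonpos (by linarith),
      zero_mul]

theorem hasDerivAt_psi_convolution {ψ w : ℝ → ℝ} (hψ : Differentiable ℝ ψ) {μ : ℝ} (hμ : μ < 1)
    (hw : ContDiff ℝ 1 w) (hws : HasCompactSupport w) (c t : ℝ) :
    HasDerivAt (fun τ => c * ∫ x, temperedKernel μ 0 x * w (ψ τ - x))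
      (c * ((∫ x, temperedKernel μ 0 x * deriv w (ψ t - x)) * deriv ψ t)) t := by
  have h := hws.hasDerivAt_convolution_right (ContinuousLinearMap.mul ℝ ℝ)
    (locallyIntegrable_temperedKernel hμ le_rfl) hw (ψ t)
  exact (h.comp t (hψ t).hasDerivAt).const_mul c

theorem leftRLDLine_eq_convolution {ψ v w : ℝ → ℝ} (hψ : Differentiable ℝ ψ)
    (hmono : StrictMono ψ) (hsurj : Function.Surjective ψ) (hψ' : ∀ t, 0 < deriv ψ t)
    (hw : ContDiff ℝ 1 w) (hws : HasCompactSupport w) (hwv : ∀ t, w (ψ t) = v t)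
    {μ : ℝ} (hμ : μ < 1) (t : ℝ) :
    leftRLDLine ψ μ v t
      = (Gamma (1 - μ))⁻¹ * ∫ x, temperedKernel μ 0 x * deriv w (ψ t - x) := by
  have := (hψ' t).ne'
  unfold leftRLDLine
  simp only [setIntegral_Iio_psi_kernel hψ hmono hsurj hψ' hwv]
  rw [(hasDerivAt_psi_convolution hψ hμ hw hws _ t).deriv]
  field_simp

theorem leftPsiD_eq_leftRLDLine {ψ v : ℝ → ℝ} {a t μ : ℝ} (hva : ∀ t ≤ a, v t = 0) (hat : a < t) :
    leftPsiD ψ a μ v t = leftRLDLine ψ μ v t := by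
  unfold leftPsiD leftRLDLine
  congr 1
  refine Filter.EventuallyEq.deriv_eq ?_
  filter_upwards [Ioi_mem_nhds hat] with τ hτ
  have hτ : a < τ := hτ
  unfold leftPsiI
  rw [show 1 - μ - 1 = -μ by ring, intervalIntegral.integral_of_le hτ.le,
    integral_Ioc_eq_integral_Ioo]
  congr 1
  refine setIntegral_eq_of_subset_of_forall_sdiff_eq_zero measurableSet_Iio
    (fun x hx => hx.2) (fun x hx => ?_) |>.symm
  rw [hva x (not_lt.1 fun h => hx.2 ⟨h, hx.1⟩), mul_zero]

/-- Coercivity identity: for `v ∈ C_c^∞(Λ)` with zero extension `v_e`,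
`(D^{δ,ψ}_t v, v)_{L²_ψ(Λ)} = cos(πδ/2) ∫_ℝ |_{-∞}D^{δ/2,ψ}_t v_e|² ψ'`, hence nonnegative. -/
theorem psi_fractional_coercivity_identity
    (δ : ℝ) (hδ0 : 0 < δ) (hδ1 : δ < 1)
    (ψ : ℝ → ℝ) (hψ : ContDiff ℝ 1 ψ) (hmono : StrictMono ψ)
    (hbij : Function.Bijective ψ) (hψ' : ∀ t, 0 < deriv ψ t)
    (a b : ℝ) (hab : a < b)
    (v : ℝ → ℝ) (hv : ContDiff ℝ (⊤ : ℕ∞) v) (hvsupp : HasCompactSupport v)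
    (hvsupp' : tsupport v ⊆ Set.Ioo a b)
    (ve : ℝ → ℝ) (hve : ∀ t ∈ Set.Ioo a b, ve t = v t)
    (hve' : ∀ t ∉ Set.Ioo a b, ve t = 0) :
    (∫ t in a..b, leftPsiD ψ a δ v t * v t * deriv ψ t)
        = Real.cos (Real.pi * δ / 2) *
          ∫ t : ℝ, (leftRLDLine ψ (δ / 2) ve t) ^ 2 * deriv ψ t
      ∧ 0 ≤ ∫ t in a..b, leftPsiD ψ a δ v t * v t * deriv ψ t := by
  have hvout : ∀ t ∉ Set.Ioo a b, v t = 0 := fun t ht =>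
    image_eq_zero_of_notMem_tsupport fun h => ht (hvsupp' h)
  have hvev : ve = v := funext fun t => by
    by_cases ht : t ∈ Set.Ioo a b
    · exact hve t ht
    · rw [hve' t ht, hvout t ht]
  subst hvev
  have hψd := hψ.differentiable one_ne_zero
  obtain ⟨w, hw, hws, hwv⟩ := exists_contDiff_comp_eq hψ hmono hbij.2 hψ'
    (hv.of_le (by exact_mod_cast le_top)) hvsupp
  have hline : ∀ {μ : ℝ}, μ < 1 → ∀ t, leftRLDLine ψ μ ve t
      = (Gamma (1 - μ))⁻¹ * ∫ x, temperedKernel μ 0 x * deriv w (ψ t - x) := fun hμ t =>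
    leftRLDLine_eq_convolution hψd hmono hbij.2 hψ' hw hws hwv hμ t
  have hleft : ∫ t in a..b, leftPsiD ψ a δ ve t * ve t * deriv ψ t
      = (Gamma (1 - δ))⁻¹ * ∫ s, w s * ∫ x, temperedKernel δ 0 x * deriv w (s - x) := by
    rw [← integral_const_mul, ← integral_deriv_mul_comp hψd hmono hbij.2 hψ'
        fun s => (Gamma (1 - δ))⁻¹ * (w s * ∫ x, temperedKernel δ 0 x * deriv w (s - x)),
      intervalIntegral.integral_of_le hab.le, integral_Ioc_eq_integral_Ioo,
      ← integral_indicator measurableSet_Ioo]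
    congr 1; ext t
    by_cases ht : t ∈ Set.Ioo a b
    · rw [Set.indicator_of_mem ht, leftPsiD_eq_leftRLDLine
        (fun t ht => hvout t fun h => absurd h.1 ht.not_gt) ht.1, hline hδ1, hwv]
      ring
    · rw [Set.indicator_of_notMem ht, hwv, hvout t ht]
      ring
  have hright : ∫ t, leftRLDLine ψ (δ / 2) ve t ^ 2 * deriv ψ t
      = (Gamma (1 - δ / 2))⁻¹ ^ 2 *
        ∫ s, (∫ x, temperedKernel (δ / 2) 0 x * deriv w (s - x)) ^ 2 := by
    rw [← integral_const_mul, ← integral_deriv_mul_comp hψd hmono hbij.2 hψ'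
      fun s => (Gamma (1 - δ / 2))⁻¹ ^ 2 *
        (∫ x, temperedKernel (δ / 2) 0 x * deriv w (s - x)) ^ 2]
    congr 1; ext t
    rw [hline (by linarith)]
    ring
  have hid := power_convolution_coercivity (α := δ / 2) (by linarith) (by linarith) hw hws
  rw [mul_div_cancel₀ δ two_ne_zero, ← hleft, ← hright, ← mul_div_assoc] at hid
  refine ⟨hid, hid ▸ mul_nonneg (cos_nonneg_of_mem_Icc ⟨?_, ?_⟩)
    (integral_nonneg fun t => mul_nonneg (sq_nonneg _) (hψ' t).le)⟩ <;> nlinarith [pi_pos]
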